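/- Fix r ∈ ℕ, a > 0, and 0 < p, q < 1. For each n, let X^n_1, …, X^n_{⌊an⌋} be disjoint n,p,q,r-uniform occupancy indicators built from n i.i.d. samples, and set Y_n = (1/n) ∑_{j=1}^{⌊an⌋} X^n_j. Then Y_n converges in probability as n → ∞ to γ = a e^{−q}(1 − e^{−p})^r. -/

import Mathlib

open MeasureTheory Filter

/-- The event that the sample `x` misses `A` and meets every `B k`. -/
def occupancyEvent {M ι κ : Type*} (A : Set M) (B : ι → Set M) : Set (κ → M) :=
  {x | (∀ i, x i ∉ A) ∧ ∀ k, ∃ i, x i ∈ B k}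

/-- The occupancy indicator, as a real-valued function of the sample. -/
noncomputable def occupancy {M ι κ : Type*} (A : Set M) (B : ι → Set M) : (κ → M) → ℝ :=
  (occupancyEvent A B).indicator 1

/-- The expectation of an occupancy indicator of `n` samples with `m` occupied sets of measure
`p / n` and an empty set of measure `q / n`, obtained by inclusion-exclusion. -/
noncomputable def occupancyMean (m : ℕ) (p q : ℝ) (n : ℕ) : ℝ :=
  ∑ s ∈ Finset.range (m + 1), (m.choose s : ℝ) * ((-1) ^ s * (1 + (-(q + s * p)) / n) ^ n)

lemma tendsto_occupancyMean (m : ℕ) (p q : ℝ) :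
    Tendsto (occupancyMean m p q) atTop
      (nhds (Real.exp (-q) * (1 - Real.exp (-p)) ^ m)) := by
  have h : Real.exp (-q) * (1 - Real.exp (-p)) ^ m =
      ∑ s ∈ Finset.range (m + 1),
        (m.choose s : ℝ) * ((-1) ^ s * Real.exp (-(q + s * p))) := by
    rw [sub_eq_neg_add, add_pow, Finset.mul_sum]
    refine Finset.sum_congr rfl fun s _ => ?_
    rw [neg_add, Real.exp_add, ← mul_neg, Real.exp_nat_mul, neg_pow]
    ring
  rw [h]
  exact tendsto_finsetSum _ fun s _ =>
    ((Real.tendsto_one_add_div_pow_exp _).const_mul _).const_mul _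

section Occupancy

variable {M ι κ : Type*}

lemma occupancy_mul {ι' : Type*} (A A' : Set M) (B : ι → Set M) (B' : ι' → Set M)
    (x : κ → M) :
    occupancy A B x * occupancy A' B' x = occupancy (A ∪ A') (Sum.elim B B') x := by
  have h : (occupancyEvent (A ∪ A') (Sum.elim B B') : Set (κ → M)) =
      occupancyEvent A B ∩ occupancyEvent A' B' := by
    ext x
    simp only [occupancyEvent, Set.mem_ofPred_eq, Set.mem_union, not_or, Sum.forall, Sum.elim_inl,
      Sum.elim_inr, forall_and, Set.mem_inter_iff]
    tauto
  rw [occupancy, occupancy, occupancy, h, Set.inter_indicator_one, Pi.mul_apply]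

lemma occupancy_mul_self (A : Set M) (B : ι → Set M) (x : κ → M) :
    occupancy A B x * occupancy A B x = occupancy A B x := by
  by_cases h : x ∈ occupancyEvent A B <;> simp [occupancy, h]

open scoped Classical in
lemma prod_indicator_compl_one [Fintype κ] (C : Set M) (x : κ → M) :
    ∏ i, Cᶜ.indicator (1 : M → ℝ) (x i) = if ∀ i, x i ∉ C then 1 else 0 := by
  simp only [Set.indicator_apply, Set.mem_compl_iff, Pi.one_apply, Finset.prod_ite_zero,
    Finset.prod_const_one, Finset.mem_univ, true_imp_iff]

lemma occupancy_eq_sum [Fintype ι] [Fintype κ] (A : Set M) (B : ι → Set M) (x : κ → M) :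
    occupancy A B x = ∑ S : Finset ι, (-1) ^ S.card *
      ∏ i, (A ∪ ⋃ k ∈ S, B k)ᶜ.indicator (1 : M → ℝ) (x i) := by
  classical
  have h : occupancy A B x = (∏ i, Aᶜ.indicator (1 : M → ℝ) (x i)) *
      ∏ k, (1 - ∏ i, (B k)ᶜ.indicator (1 : M → ℝ) (x i)) := by
    simp only [prod_indicator_compl_one]
    have h' : ∀ k, (1 : ℝ) - (if ∀ i, x i ∉ B k then 1 else 0) =
        if ∃ i, x i ∈ B k then 1 else 0 := by
      intro k
      by_cases hk : ∃ i, x i ∈ B k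
      · rw [if_pos hk, if_neg (by simpa using hk), sub_zero]
      · rw [if_neg hk, if_pos (by simpa using hk), sub_self]
    simp only [h', Finset.prod_ite_zero, Finset.mem_univ, true_imp_iff, Finset.prod_const_one,
      ite_zero_mul_ite_zero, mul_one, occupancy, occupancyEvent, Set.indicator_apply,
      Set.mem_ofPred_eq, Pi.one_apply]
  have hunion : ∀ (S : Finset ι) (y : M), (A ∪ ⋃ k ∈ S, B k)ᶜ.indicator (1 : M → ℝ) y =
      Aᶜ.indicator 1 y * ∏ k ∈ S, (B k)ᶜ.indicator 1 y := by
    intro S y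
    simp only [Set.indicator_apply, Pi.one_apply, Finset.prod_ite_zero, Finset.prod_const_one,
      ite_zero_mul_ite_zero, mul_one, Set.mem_compl_iff, Set.mem_union, Set.mem_iUnion, not_or,
      not_exists]
  rw [h, Finset.prod_sub, Finset.powerset_univ, Finset.mul_sum]
  refine Finset.sum_congr rfl fun S _ => ?_
  simp only [hunion, Finset.prod_mul_distrib, Finset.prod_const_one, mul_one]
  rw [Finset.prod_comm (s := S)]
  ring

variable [MeasurableSpace M]

lemma measurableSet_occupancyEvent [Countable ι] [Countable κ] {A : Set M} {B : ι → Set M}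
    (hA : MeasurableSet A) (hB : ∀ k, MeasurableSet (B k)) :
    MeasurableSet (occupancyEvent A B : Set (κ → M)) := by
  have h : (occupancyEvent A B : Set (κ → M)) =
      (⋂ i, (fun x => x i) ⁻¹' Aᶜ) ∩ ⋂ k, ⋃ i, (fun x => x i) ⁻¹' B k := by
    ext x; simp [occupancyEvent]
  rw [h]
  exact (MeasurableSet.iInter fun i => measurable_pi_apply i hA.compl).inter
    (MeasurableSet.iInter fun k => MeasurableSet.iUnion fun i => measurable_pi_apply i (hB k))

lemma integrable_occupancy [Countable ι] [Countable κ] {A : Set M} {B : ι → Set M}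
    (hA : MeasurableSet A) (hB : ∀ k, MeasurableSet (B k))
    (μ : Measure (κ → M)) [IsFiniteMeasure μ] : Integrable (occupancy A B) μ :=
  (integrable_const (1 : ℝ)).indicator (measurableSet_occupancyEvent hA hB)

lemma integral_occupancy [Fintype ι] {n : ℕ} (ν : Measure M)
    [IsProbabilityMeasure ν] {A : Set M} {B : ι → Set M} {p q : ℝ}
    (hA : MeasurableSet A) (hB : ∀ k, MeasurableSet (B k))
    (hAq : ν.real A = q / n) (hBp : ∀ k, ν.real (B k) = p / n)
    (hAB : ∀ k, Disjoint A (B k)) (hBB : Pairwise fun k k' => Disjoint (B k) (B k')) :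
    ∫ x, occupancy A B x ∂(Measure.pi fun _ : Fin n => ν) =
      occupancyMean (Fintype.card ι) p q n := by
  have hmeas : ∀ S : Finset ι, MeasurableSet (A ∪ ⋃ k ∈ S, B k)ᶜ := fun S =>
    (hA.union (S.measurableSet_biUnion fun k _ => hB k)).compl
  have hterm : ∀ S : Finset ι,
      ∫ x, ∏ i, (A ∪ ⋃ k ∈ S, B k)ᶜ.indicator (1 : M → ℝ) (x i)
        ∂(Measure.pi fun _ : Fin n => ν) = (1 + (-(q + S.card * p)) / n) ^ n := by
    intro S
    rw [integral_fintype_prod_eq_prod (fun _ => (A ∪ ⋃ k ∈ S, B k)ᶜ.indicator (1 : M → ℝ)),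
      Finset.prod_const, Finset.card_univ, Fintype.card_fin, integral_indicator_one (hmeas S),
      measureReal_compl (hmeas S).of_compl, probReal_univ,
      measureReal_union (by simpa using fun k _ => hAB k)
        (S.measurableSet_biUnion fun k _ => hB k) (measure_ne_top _ _) (measure_ne_top _ _),
      measureReal_biUnion_finset (fun k _ k' _ h => hBB h) (fun k _ => hB k), hAq]
    simp only [hBp, Finset.sum_const, nsmul_eq_mul]
    ring
  simp only [occupancy_eq_sum]
  rw [integral_finsetSum]
  · simp only [integral_const_mul, hterm]
    rw [← Finset.powerset_univ,
      Finset.sum_powerset_apply_card (fun s : ℕ => (-1) ^ s * (1 + (-(q + s * p)) / n) ^ n)]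
    simp [occupancyMean]
  · intro S _
    exact (Integrable.fintype_prod (f := fun _ : Fin n =>
      (A ∪ ⋃ k ∈ S, B k)ᶜ.indicator (1 : M → ℝ)) fun _ =>
        (integrable_const (1 : ℝ)).indicator (hmeas S)).const_mul _

lemma integral_occupancy_mul [Fintype ι] {n : ℕ} (ν : Measure M)
    [IsProbabilityMeasure ν] {A A' : Set M} {B B' : ι → Set M} {p q : ℝ}
    (hA : MeasurableSet A) (hB : ∀ k, MeasurableSet (B k))
    (hA' : MeasurableSet A') (hB' : ∀ k, MeasurableSet (B' k))
    (hAq : ν.real A = q / n) (hBp : ∀ k, ν.real (B k) = p / n)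
    (hAq' : ν.real A' = q / n) (hBp' : ∀ k, ν.real (B' k) = p / n)
    (hAB : ∀ k, Disjoint A (B k)) (hBB : Pairwise fun k k' => Disjoint (B k) (B k'))
    (hAB' : ∀ k, Disjoint A' (B' k)) (hBB' : Pairwise fun k k' => Disjoint (B' k) (B' k'))
    (hdisj : Disjoint (A ∪ ⋃ k, B k) (A' ∪ ⋃ k, B' k)) :
    ∫ x, occupancy A B x * occupancy A' B' x ∂(Measure.pi fun _ : Fin n => ν) =
      occupancyMean (2 * Fintype.card ι) p (2 * q) n := by
  simp only [Set.disjoint_union_left, Set.disjoint_union_right, Set.disjoint_iUnion_left,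
    Set.disjoint_iUnion_right] at hdisj
  obtain ⟨⟨hAA, hBA⟩, hX⟩ := hdisj
  simp only [occupancy_mul]
  rw [integral_occupancy ν (p := p) (q := 2 * q) (hA.union hA') (Sum.rec hB hB'),
    Fintype.card_sum, two_mul (Fintype.card ι)]
  · rw [measureReal_union hAA hA', hAq, hAq']
    ring
  · exact Sum.rec hBp hBp'
  · rintro (k | k)
    · exact (hAB k).union_left (hBA k).symm
    · exact (hX k).1.union_left (hAB' k)
  · rintro (k | k) (l | l) h
    · exact hBB (by simpa using h)
    · exact (hX l).2 k
    · exact ((hX k).2 l).symm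
    · exact hBB' (by simpa using h)

end Occupancy

/-- The mean square deviation from `c` of a normalised sum of functions with prescribed first and
mixed second moments. -/
lemma integral_sq_mul_sum_sub {Ω : Type*} [MeasurableSpace Ω] (μ : Measure Ω)
    [IsProbabilityMeasure μ] {N : ℕ} (X : Fin N → Ω → ℝ) (t c f g : ℝ)
    (hint : ∀ j, Integrable (X j) μ) (hint₂ : ∀ i j, Integrable (fun x => X i x * X j x) μ)
    (hf : ∀ j, ∫ x, X j x ∂μ = f)
    (hg : ∀ i j, ∫ x, X i x * X j x ∂μ = if i = j then f else g) :
    Integrable (fun x => (t * ∑ j, X j x - c) ^ 2) μ ∧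
    ∫ x, (t * ∑ j, X j x - c) ^ 2 ∂μ =
      t ^ 2 * (N * f + (N ^ 2 - N) * g) - 2 * t * c * (N * f) + c ^ 2 := by
  have h : ∀ x, (t * ∑ j, X j x - c) ^ 2 =
      t ^ 2 * (∑ i, ∑ j, X i x * X j x) - 2 * t * c * (∑ j, X j x) + c ^ 2 := by
    intro x
    rw [← Finset.sum_mul_sum]
    ring
  have h₁ : Integrable (fun x => 2 * t * c * ∑ j, X j x) μ :=
    (integrable_finsetSum _ fun j _ => hint j).const_mul _
  have h₂ : Integrable (fun x => t ^ 2 * ∑ i, ∑ j, X i x * X j x) μ :=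
    (integrable_finsetSum _ fun i _ => integrable_finsetSum _ fun j _ => hint₂ i j).const_mul _
  simp only [h]
  refine ⟨(h₂.sub h₁).add (integrable_const _), ?_⟩
  rw [integral_add (by exact h₂.sub h₁) (integrable_const _), integral_sub h₂ h₁, integral_const_mul,
    integral_const_mul, integral_finsetSum _ fun j _ => hint j,
    integral_finsetSum _ fun i _ => integrable_finsetSum _ fun j _ => hint₂ i j]
  have hrow : ∀ i, ∫ x, ∑ j, X i x * X j x ∂μ = f + (N - 1) * g := by
    intro i
    rw [integral_finsetSum _ fun j _ => hint₂ i j]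
    have hsplit : ∀ j, (if i = j then f else g) = g + if i = j then f - g else 0 := by
      intro j; split_ifs <;> ring
    simp only [hg, hsplit, Finset.sum_add_distrib, Finset.sum_ite_eq, Finset.mem_univ, if_true,
      Finset.sum_const, Finset.card_univ, Fintype.card_fin, nsmul_eq_mul]
    ring
  simp only [hrow, hf, Finset.sum_const, Finset.card_univ, Fintype.card_fin, nsmul_eq_mul,
    integral_const, probReal_univ, one_smul]
  ring

open scoped Classical in
/-- weak law of large numbers for disjoint `n,p,q,r`-uniform occupancy
indicators.  For each `n`, the `⌊an⌋` indicators are built from the sets `A n j`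
(of measure `q/n`) and the `r` sets `B n j k` (each of measure `p/n`), all pairwise
disjoint, with the unions for different `j` disjoint.  The normalized sum `Y_n` of
the indicators evaluated on `n` i.i.d. samples from `ν n` converges in probability
to `γ = a e^{−q}(1 − e^{−p})^r`. -/
theorem stmt8 {M : Type*} [MeasurableSpace M]
    (r : ℕ) (a p q : ℝ) (ha : 0 < a) (hp : 0 < p) (hp1 : p < 1)
    (hq : 0 < q) (hq1 : q < 1)
    (ν : ℕ → Measure M) [∀ n, IsProbabilityMeasure (ν n)]
    (A : (n : ℕ) → Fin ⌊a * n⌋₊ → Set M)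
    (B : (n : ℕ) → Fin ⌊a * n⌋₊ → Fin r → Set M)
    (hAmeas : ∀ n j, MeasurableSet (A n j))
    (hBmeas : ∀ n j k, MeasurableSet (B n j k))
    (hAq : ∀ n : ℕ, 0 < n → ∀ j, ν n (A n j) = ENNReal.ofReal (q / n))
    (hBp : ∀ n : ℕ, 0 < n → ∀ j k, ν n (B n j k) = ENNReal.ofReal (p / n))
    (hABdisj : ∀ n j k, Disjoint (A n j) (B n j k))
    (hBdisj : ∀ n j, Pairwise fun k k' => Disjoint (B n j k) (B n j k'))
    (hInddisj : ∀ n, Pairwise fun j j' =>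
      Disjoint (A n j ∪ ⋃ k, B n j k) (A n j' ∪ ⋃ k, B n j' k)) :
    ∀ ε : ℝ, 0 < ε →
      Tendsto (fun n : ℕ =>
        (Measure.pi fun _ : Fin n => ν n)
          {x : Fin n → M | ε <
            |(1 / (n : ℝ)) * ∑ j : Fin ⌊a * n⌋₊,
                (if (∀ i, x i ∉ A n j) ∧ (∀ k, ∃ i, x i ∈ B n j k) then (1 : ℝ) else 0)
              - a * Real.exp (-q) * (1 - Real.exp (-p)) ^ r|})
        atTop (nhds 0) := by
  intro ε hε
  set γ := a * Real.exp (-q) * (1 - Real.exp (-p)) ^ r with hγ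
  let μ : (n : ℕ) → Measure (Fin n → M) := fun n => Measure.pi fun _ => ν n
  let Y : (n : ℕ) → (Fin n → M) → ℝ := fun n x =>
    1 / (n : ℝ) * ∑ j, occupancy (A n j) (B n j) x
  let V : ℕ → ℝ := fun n =>
    (1 / (n : ℝ)) ^ 2 * (⌊a * n⌋₊ * occupancyMean r p q n +
      ((⌊a * n⌋₊ : ℝ) ^ 2 - ⌊a * n⌋₊) * occupancyMean (2 * r) p (2 * q) n) -
      2 * (1 / (n : ℝ)) * γ * (⌊a * n⌋₊ * occupancyMean r p q n) + γ ^ 2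
  have hY : ∀ n : ℕ, 0 < n → Integrable (fun x => (Y n x - γ) ^ 2) (μ n) ∧
      ∫ x, (Y n x - γ) ^ 2 ∂(μ n) = V n := by
    intro n hn
    have hA' : ∀ j, (ν n).real (A n j) = q / n := fun j => by
      rw [measureReal_def, hAq n hn, ENNReal.toReal_ofReal (by positivity)]
    have hB' : ∀ j k, (ν n).real (B n j k) = p / n := fun j k => by
      rw [measureReal_def, hBp n hn, ENNReal.toReal_ofReal (by positivity)]
    have hmean : ∀ j, ∫ x, occupancy (A n j) (B n j) x ∂(μ n) = occupancyMean r p q n := by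
      intro j
      simpa using integral_occupancy (ν n) (hAmeas n j) (hBmeas n j) (hA' j) (hB' j)
        (hABdisj n j) (hBdisj n j)
    refine integral_sq_mul_sum_sub (μ n) (fun j => occupancy (A n j) (B n j)) _ γ _ _
      (fun j => integrable_occupancy (hAmeas n j) (hBmeas n j) _) (fun i j => ?_) hmean
      fun i j => ?_
    · simp only [occupancy_mul]
      exact integrable_occupancy ((hAmeas n i).union (hAmeas n j))
        (Sum.rec (hBmeas n i) (hBmeas n j)) _
    · split_ifs with hij
      · subst hij
        simpa only [occupancy_mul_self] using hmean i
      · simpa using integral_occupancy_mul (ν n) (hAmeas n i) (hBmeas n i) (hAmeas n j)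
          (hBmeas n j) (hA' i) (hB' i) (hA' j) (hB' j) (hABdisj n i) (hBdisj n i)
          (hABdisj n j) (hBdisj n j) (hInddisj n hij)
  have hV : Tendsto V atTop (nhds 0) := by
    have hN : Tendsto (fun n : ℕ => (⌊a * n⌋₊ : ℝ) / n) atTop (nhds a) :=
      (tendsto_nat_floor_mul_div_atTop ha.le).comp tendsto_natCast_atTop_atTop
    have h0 : Tendsto (fun n : ℕ => 1 / (n : ℝ)) atTop (nhds 0) :=
      tendsto_one_div_atTop_nhds_zero_nat
    have h1 := tendsto_occupancyMean r p q
    have h2 := tendsto_occupancyMean (2 * r) p (2 * q)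
    have h := (((h0.mul (hN.mul h1)).add (((hN.pow 2).sub (h0.mul hN)).mul h2)).sub
      ((hN.mul h1).const_mul (2 * γ))).add_const (γ ^ 2)
    convert h using 1
    · funext n
      simp only [V]
      ring
    · congr 1
      rw [hγ, show -(2 * q) = -q + -q by ring, Real.exp_add, mul_comm 2 r, pow_mul]
      ring
  have hbound : Tendsto (fun n => ENNReal.ofReal (V n / ε ^ 2)) atTop (nhds 0) := by
    simpa using ENNReal.tendsto_ofReal (hV.div_const (ε ^ 2))
  refine tendsto_of_tendsto_of_tendsto_of_le_of_le' tendsto_const_nhds hbound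
    (Eventually.of_forall fun _ => zero_le) ?_
  filter_upwards [eventually_gt_atTop 0] with n hn
  obtain ⟨hint, hval⟩ := hY n hn
  have hmarkov := mul_meas_ge_le_integral_of_nonneg
    (Eventually.of_forall fun x => sq_nonneg (Y n x - γ)) hint (ε ^ 2)
  rw [hval, mul_comm, ← le_div_iff₀ (by positivity)] at hmarkov
  calc
    _ ≤ μ n {x | ε ^ 2 ≤ (Y n x - γ) ^ 2} := by
      refine measure_mono fun x hx => ?_
      have hx' : ε < |Y n x - γ| := by
        simpa only [Y, occupancy, occupancyEvent, Set.indicator_apply, Set.mem_ofPred_eq,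
          Pi.one_apply] using hx
      rw [Set.mem_ofPred_eq, ← sq_abs (Y n x - γ)]
      exact pow_le_pow_left₀ hε.le hx'.le 2
    _ = ENNReal.ofReal ((μ n).real {x | ε ^ 2 ≤ (Y n x - γ) ^ 2}) := by
      rw [ofReal_measureReal]
    _ ≤ _ := ENNReal.ofReal_le_ofReal hmarkov
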